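/- For every interval I ⊆ ℝ, every r > 0 and every measurable function f : I → ℝ that is integrable on every bounded measurable subset of I, one has the doubling inequality |f|²_{Ḣ^{1/2}_{2r}(I)} ≤ 3 |f|²_{Ḣ^{1/2}_r(I)} (in [0, +∞]). -/

import Mathlib

open MeasureTheory Set Filter
open scoped ENNReal BigOperators

noncomputable def screenedSeminorm (I : Set ℝ) (r : ℝ) (f : ℝ → ℝ) : ℝ≥0∞ :=
  (∫⁻ x in I, ∫⁻ y in I ∩ Set.Ioo (x - r) (x + r),
      ENNReal.ofReal ((f y - f x) ^ 2 / (y - x) ^ 2)) ^ (1 / 2 : ℝ)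

def LocIntOn (I : Set ℝ) (f : ℝ → ℝ) : Prop :=
  ∀ s : Set ℝ, s ⊆ I → MeasurableSet s → Bornology.IsBounded s →
    MeasureTheory.IntegrableOn f s

noncomputable def avgOn (J : Set ℝ) (f : ℝ → ℝ) : ℝ :=
  (MeasureTheory.volume J).toReal⁻¹ * ∫ x in J, f x

open Classical in
/-- The kernel of the squared screened seminorm, extended by zero outside
`{(x, y) ∈ I × I | |y - x| < r}`. -/
noncomputable def screenedKernel (I : Set ℝ) (r : ℝ) (f : ℝ → ℝ) (x y : ℝ) : ℝ≥0∞ :=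
  if x ∈ I ∧ y ∈ I ∧ |y - x| < r then ENNReal.ofReal ((f y - f x) ^ 2 / (y - x) ^ 2) else 0

lemma measurable_screenedKernel {I : Set ℝ} (hI : MeasurableSet I) (r : ℝ) {f : ℝ → ℝ}
    (hf : Measurable f) : Measurable (fun p : ℝ × ℝ => screenedKernel I r f p.1 p.2) := by
  unfold screenedKernel
  refine Measurable.ite ?_ ?_ measurable_const
  · exact (measurable_fst hI).inter ((measurable_snd hI).inter
      (measurableSet_lt (f := fun p : ℝ × ℝ => |p.2 - p.1|) (by fun_prop) measurable_const))
  · fun_prop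

lemma lintegral_comp_midpoint (x : ℝ) {g : ℝ → ℝ≥0∞} (hg : Measurable g) :
    ∫⁻ y, g ((x + y) / 2) = 2 * ∫⁻ m, g m := by
  have h := Real.smul_map_volume_mul_left (a := 1 / 2) (by norm_num)
  have h1 : ∫⁻ m, g m = ENNReal.ofReal |1 / 2| * ∫⁻ y, g (1 / 2 * y) := by
    conv_lhs => rw [← h]
    rw [lintegral_smul_measure, lintegral_map hg (by fun_prop), smul_eq_mul]
  have h2 : ∫⁻ y, g (1 / 2 * y) = ∫⁻ y, g ((x + y) / 2) := by
    rw [← lintegral_add_left_eq_self _ x]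
    refine lintegral_congr fun y => ?_
    congr 1
    ring
  rw [h1, h2, ← mul_assoc, ← ENNReal.ofReal_ofNat 2, ← ENNReal.ofReal_mul (by norm_num)]
  norm_num

lemma screenedKernel_two_mul_le {I : Set ℝ} (hI : I.OrdConnected) (r : ℝ) (f : ℝ → ℝ)
    (x y : ℝ) :
    screenedKernel I (2 * r) f x y ≤
      2⁻¹ * (screenedKernel I r f x ((x + y) / 2) + screenedKernel I r f y ((y + x) / 2)) := by
  by_cases h : x ∈ I ∧ y ∈ I ∧ |y - x| < 2 * r
  · obtain ⟨hx, hy, hxy⟩ := h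
    have hm : (x + y) / 2 ∈ I := by
      rcases le_total x y with hle | hle
      · exact hI.out hx hy ⟨by linarith, by linarith⟩
      · exact hI.out hy hx ⟨by linarith, by linarith⟩
    have h1 : |(x + y) / 2 - x| < r := by
      rw [abs_lt] at hxy ⊢
      constructor <;> linarith
    have h2 : |(x + y) / 2 - y| < r := by
      rw [abs_lt] at hxy ⊢
      constructor <;> linarith
    rw [add_comm y x, screenedKernel, screenedKernel, screenedKernel, if_pos ⟨hx, hy, hxy⟩,
      if_pos ⟨hx, hm, h1⟩, if_pos ⟨hy, hm, h2⟩,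
      ← ENNReal.ofReal_add (by positivity) (by positivity), ← ENNReal.ofReal_ofNat 2,
      ← ENNReal.ofReal_inv_of_pos (by norm_num), ← ENNReal.ofReal_mul (by norm_num)]
    apply ENNReal.ofReal_le_ofReal
    have e1 : ((x + y) / 2 - x) ^ 2 = (y - x) ^ 2 / 4 := by ring
    have e2 : ((x + y) / 2 - y) ^ 2 = (y - x) ^ 2 / 4 := by ring
    rw [e1, e2, ← add_div, div_div_eq_mul_div, ← mul_div_assoc]
    gcongr
    nlinarith [sq_nonneg (f x + f y - 2 * f ((x + y) / 2))]
  · rw [screenedKernel, if_neg h]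
    exact zero_le

lemma lintegral_screenedKernel_two_mul_le {I : Set ℝ} (hI : I.OrdConnected) (r : ℝ)
    {f : ℝ → ℝ} (hf : Measurable f) :
    ∫⁻ x, ∫⁻ y, screenedKernel I (2 * r) f x y ≤ 2 * ∫⁻ x, ∫⁻ y, screenedKernel I r f x y := by
  have hK := measurable_screenedKernel hI.measurableSet r hf
  have hA : Measurable fun p : ℝ × ℝ => screenedKernel I r f p.1 ((p.1 + p.2) / 2) :=
    hK.comp (f := fun p : ℝ × ℝ => (p.1, (p.1 + p.2) / 2)) (by fun_prop)
  have hB : Measurable fun p : ℝ × ℝ => screenedKernel I r f p.2 ((p.2 + p.1) / 2) :=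
    hA.comp measurable_swap
  have hmid : ∫⁻ x, ∫⁻ y, screenedKernel I r f x ((x + y) / 2) =
      2 * ∫⁻ x, ∫⁻ y, screenedKernel I r f x y := by
    rw [← lintegral_const_mul _ hK.lintegral_prod_right']
    exact lintegral_congr fun x => lintegral_comp_midpoint x (hK.comp measurable_prodMk_left)
  calc ∫⁻ x, ∫⁻ y, screenedKernel I (2 * r) f x y
      ≤ ∫⁻ x, ∫⁻ y, 2⁻¹ *
          (screenedKernel I r f x ((x + y) / 2) + screenedKernel I r f y ((y + x) / 2)) := by
        gcongr with x y
        exact screenedKernel_two_mul_le hI r f x y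
    _ = 2⁻¹ * ((∫⁻ x, ∫⁻ y, screenedKernel I r f x ((x + y) / 2)) +
          ∫⁻ x, ∫⁻ y, screenedKernel I r f y ((y + x) / 2)) := by
        rw [← lintegral_add_left hA.lintegral_prod_right', ← lintegral_const_mul' _ _ (by simp)]
        refine lintegral_congr fun x => ?_
        rw [lintegral_const_mul' _ _ (by simp)]
        congr 1
        exact lintegral_add_left (hA.comp measurable_prodMk_left) _
    _ = 2 * ∫⁻ x, ∫⁻ y, screenedKernel I r f x y := by
        rw [lintegral_lintegral_swap (f := fun x y => screenedKernel I r f y ((y + x) / 2))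
          hB.aemeasurable, hmid, ← two_mul, ← mul_assoc, ENNReal.inv_mul_cancel (by simp) (by simp),
          one_mul]

lemma screenedSeminorm_sq {I : Set ℝ} (hI : MeasurableSet I) (r : ℝ) (f : ℝ → ℝ) :
    screenedSeminorm I r f ^ 2 = ∫⁻ x, ∫⁻ y, screenedKernel I r f x y := by
  rw [screenedSeminorm, ← ENNReal.rpow_natCast, ← ENNReal.rpow_mul]
  norm_num
  rw [← lintegral_indicator hI]
  refine lintegral_congr fun x => ?_
  by_cases hx : x ∈ I
  · rw [indicator_of_mem hx, ← lintegral_indicator (hI.inter measurableSet_Ioo)]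
    refine lintegral_congr fun y => ?_
    unfold screenedKernel
    classical rw [indicator_apply]
    congr 1
    simp only [mem_inter_iff, mem_Ioo, abs_lt, hx, true_and, eq_iff_iff]
    refine and_congr_right fun _ => and_congr ?_ ?_ <;> constructor <;> intro h <;> linarith
  · simp [screenedKernel, hx]

lemma screenedSeminorm_congr_ae {I : Set ℝ} (r : ℝ) {f g : ℝ → ℝ}
    (h : f =ᵐ[volume.restrict I] g) : screenedSeminorm I r f = screenedSeminorm I r g := by
  unfold screenedSeminorm
  congr 1
  refine lintegral_congr_ae (h.mono fun x hx => ?_)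
  refine lintegral_congr_ae ((ae_restrict_of_ae_restrict_of_subset inter_subset_left h).mono
    fun y hy => ?_)
  simp only [hx, hy]

lemma LocIntOn.aemeasurable {I : Set ℝ} (hI : MeasurableSet I) {f : ℝ → ℝ} (hf : LocIntOn I f) :
    AEMeasurable f (volume.restrict I) := by
  have hcover : I = ⋃ n : ℕ, I ∩ Metric.closedBall (0 : ℝ) n := by
    rw [← inter_iUnion, Metric.iUnion_closedBall_nat, inter_univ]
  rw [hcover, aemeasurable_iUnion_iff]
  exact fun n => (hf _ inter_subset_left (hI.inter measurableSet_closedBall)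
    (Metric.isBounded_closedBall.subset inter_subset_right)).aemeasurable

/-- the doubling inequality
`|f|²_{Ḣ^{1/2}_{2r}(I)} ≤ 3 |f|²_{Ḣ^{1/2}_r(I)}` (in `[0, +∞]`) for every interval
`I ⊆ ℝ`, every `r > 0` and every locally integrable `f : I → ℝ`. -/
theorem statement1 (I : Set ℝ) (hI : I.OrdConnected) (r : ℝ) (hr : 0 < r)
    (f : ℝ → ℝ) (hf : LocIntOn I f) :
    screenedSeminorm I (2 * r) f ^ 2 ≤ 3 * screenedSeminorm I r f ^ 2 := by
  have hm := hI.measurableSet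
  obtain ⟨g, hg, hfg⟩ := hf.aemeasurable hm
  rw [screenedSeminorm_congr_ae _ hfg, screenedSeminorm_congr_ae _ hfg, screenedSeminorm_sq hm,
    screenedSeminorm_sq hm]
  refine (lintegral_screenedKernel_two_mul_le hI r hg).trans ?_
  gcongr
  norm_num
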